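/- arXiv:1803.05657 — 2 statements merged into one kernel-verified Lean document; each statement's English description precedes it below -/
import Mathlib

section
/- Let X ∈ ℝ^{D×(p₁p₂)} be a real matrix whose columns are indexed by pairs in Fin p₁ × Fin p₂, and let C1 ∈ ℝ^{p₁×p₁}, C2 ∈ ℝ^{p₂×p₂}. For each row index i, let Mᵢ ∈ ℝ^{p₂×p₁} be the reshaping of the i-th row of X given by (Mᵢ)_{b,a} = X_{i,(a,b)}. Then ‖X − X(C1 ⊗ C2)‖_F² = Σ_{i=1}^{D} ‖Mᵢ − C2ᵀ Mᵢ C1‖_F². -/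
open Matrix Kronecker

/-- Reformulation of the self-expressiveness loss (paper's Eqs. (5)–(7)):
if `Mᵢ` is the `p₂ × p₁` reshaping of the `i`-th row of `X`
(so `Mᵢ b a = X i (a, b)`), then
`‖X − X (C1 ⊗ C2)‖_F² = ∑ i, ‖Mᵢ − C2ᵀ Mᵢ C1‖_F²`. -/
theorem selfExpress_loss_reshape (D p₁ p₂ : ℕ)
    (X : Matrix (Fin D) (Fin p₁ × Fin p₂) ℝ)
    (C1 : Matrix (Fin p₁) (Fin p₁) ℝ) (C2 : Matrix (Fin p₂) (Fin p₂) ℝ)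
    (M : Fin D → Matrix (Fin p₂) (Fin p₁) ℝ)
    (hM : ∀ i a b, M i b a = X i (a, b)) :
    (∑ i, ∑ c, ((X - X * (C1 ⊗ₖ C2)) i c) ^ 2) =
      ∑ i, ∑ b, ∑ a, ((M i - C2ᵀ * M i * C1) b a) ^ 2 := by
  have mul_kronecker_apply (i : Fin D) (a : Fin p₁) (b : Fin p₂) :
      (X * (C1 ⊗ₖ C2)) i (a, b) = (C2ᵀ * M i * C1) b a := by
    simp only [Matrix.mul_apply, Fintype.sum_prod_type, kroneckerMap_apply, transpose_apply,
      Finset.sum_mul, hM]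
    refine Finset.sum_congr rfl fun a' _ => Finset.sum_congr rfl fun b' _ => ?_
    ring
  refine Finset.sum_congr rfl fun i _ => ?_
  rw [Fintype.sum_prod_type_right]
  simp only [Matrix.sub_apply, mul_kronecker_apply, hM]
end

section
/- Let M ∈ ℝ^{n×n} (n ≥ 1) be a symmetric real matrix and let λ be its largest eigenvalue, with λ ≥ 0. Then for every a ∈ ℝⁿ, (aᵀa)² − 2 aᵀ M a ≥ −λ², and equality is attained: if v is a unit eigenvector of M with M v = λ v, then a = √λ · v satisfies (aᵀa)² − 2 aᵀ M a = −λ². Consequently the minimum of a ↦ (aᵀa)² − 2 aᵀ M a is −λ², attained at a vector proportional to an eigenvector for the largest eigenvalue of M. -/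
open Matrix

/-- If every real eigenvalue of a symmetric real matrix is at most `c`, then its quadratic form is
bounded above by `c` times the squared Euclidean length. -/
lemma Matrix.IsSymm.dotProduct_mulVec_le {ι : Type*} [Fintype ι] {M : Matrix ι ι ℝ}
    (hM : M.IsSymm) {c : ℝ}
    (hc : ∀ (μ : ℝ) (v : ι → ℝ), v ≠ 0 → M *ᵥ v = μ • v → μ ≤ c) (a : ι → ℝ) :
    a ⬝ᵥ (M *ᵥ a) ≤ c * (a ⬝ᵥ a) := by
  classical
  have hN : (c • (1 : Matrix ι ι ℝ) - M).IsHermitian := by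
    simp [Matrix.IsHermitian, Matrix.conjTranspose_eq_transpose_of_trivial, hM.eq]
  have hpos : (c • (1 : Matrix ι ι ℝ) - M).PosSemidef := by
    refine hN.posSemidef_iff_eigenvalues_nonneg.mpr fun i => ?_
    have hne : (⇑(hN.eigenvectorBasis i) : ι → ℝ) ≠ 0 := fun h =>
      hN.eigenvectorBasis.orthonormal.ne_zero i (by ext j; exact congrFun h j)
    have heig := hN.mulVec_eigenvectorBasis i
    rw [Matrix.sub_mulVec, Matrix.smul_mulVec, Matrix.one_mulVec] at heig
    have hle := hc (c - hN.eigenvalues i) _ hne (by rw [sub_smul, ← heig]; abel)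
    simpa using hle
  have hquad := hpos.dotProduct_mulVec_nonneg a
  simp only [star_trivial, Matrix.sub_mulVec, Matrix.smul_mulVec, Matrix.one_mulVec,
    dotProduct_sub, dotProduct_smul, smul_eq_mul] at hquad
  linarith

/-- Convergence claim of the paper: for a symmetric matrix `M` with largest
eigenvalue `λ ≥ 0`, the function `a ↦ (aᵀa)² − 2 aᵀ M a` is bounded below by
`−λ²`, and this bound is attained at `a = √λ • v` for any unit eigenvector `v`
of `M` with eigenvalue `λ`; hence the minimum is `−λ²`, attained at a vector
proportional to an eigenvector for the largest eigenvalue. -/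
theorem min_of_kron_approx_loss (n : ℕ) (hn : 1 ≤ n)
    (M : Matrix (Fin n) (Fin n) ℝ) (hM : M.IsSymm)
    (lam : ℝ) (hlam0 : 0 ≤ lam)
    (hev : ∃ v : Fin n → ℝ, v ≠ 0 ∧ M *ᵥ v = lam • v)
    (hmax : ∀ (μ : ℝ) (v : Fin n → ℝ), v ≠ 0 → M *ᵥ v = μ • v → μ ≤ lam) :
    (∀ a : Fin n → ℝ,
        -lam ^ 2 ≤ (a ⬝ᵥ a) ^ 2 - 2 * (a ⬝ᵥ (M *ᵥ a))) ∧
      ∀ v : Fin n → ℝ, v ⬝ᵥ v = 1 → M *ᵥ v = lam • v →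
        ((Real.sqrt lam • v) ⬝ᵥ (Real.sqrt lam • v)) ^ 2 -
            2 * ((Real.sqrt lam • v) ⬝ᵥ (M *ᵥ (Real.sqrt lam • v))) = -lam ^ 2 := by
  refine ⟨fun a => ?_, fun v hv hMv => ?_⟩
  · nlinarith [hM.dotProduct_mulVec_le hmax a, sq_nonneg (a ⬝ᵥ a - lam)]
  · simp only [Matrix.mulVec_smul, hMv, smul_dotProduct, dotProduct_smul, hv, smul_eq_mul, mul_one]
    linear_combination (√lam * √lam - lam) * Real.mul_self_sqrt hlam0
end
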